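/- Let S be a smooth symmetric 2-tensor field on the upper half-plane H² = {(x,y) ∈ ℝ² : y > 0}, with components S₁₁, S₁₂ = S₂₁, S₂₂. Then S satisfies the covariant closedness equations DS = 0 for the hyperbolic metric, namely ∂_x S₁₂ + (S₁₁ − S₂₂)/y = ∂_y S₁₁ + 2S₁₁/y and ∂_x S₂₂ = ∂_y S₁₂ on H², if and only if there exists a smooth function E : H² → ℝ with S₁₁ = E_xx − E_y/y − E/y², S₁₂ = E_xy + E_x/y, and S₂₂ = E_yy + E_y/y − E/y² on H², i.e. S = ∇dE + RgE. -/

import Mathlib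

/-- Partial derivative in the first coordinate direction on `ℝ²`. -/
noncomputable def pdx (f : (ℝ × ℝ) → ℝ) (z : ℝ × ℝ) : ℝ := fderiv ℝ f z (1, 0)

/-- Partial derivative in the second coordinate direction on `ℝ²`. -/
noncomputable def pdy (f : (ℝ × ℝ) → ℝ) (z : ℝ × ℝ) : ℝ := fderiv ℝ f z (0, 1)

/-- The upper half-plane `H² = {(x, y) : y > 0}`. -/
def UHP : Set (ℝ × ℝ) := {z : ℝ × ℝ | 0 < z.2}

open scoped ContDiff Topology

lemma isOpen_UHP : IsOpen UHP := isOpen_lt continuous_const continuous_snd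

lemma convex_UHP : Convex ℝ UHP :=
  convex_halfSpace_gt (LinearMap.snd ℝ ℝ ℝ).isLinear 0

lemma UHP_mem_nhds {z : ℝ × ℝ} (hz : z ∈ UHP) : UHP ∈ 𝓝 z := isOpen_UHP.mem_nhds hz

lemma ContDiffOn.differentiableAt_of_mem_UHP {f : ℝ × ℝ → ℝ} (hf : ContDiffOn ℝ ∞ f UHP)
    {z : ℝ × ℝ} (hz : z ∈ UHP) : DifferentiableAt ℝ f z :=
  (hf.contDiffAt (UHP_mem_nhds hz)).differentiableAt (by simp)

lemma ContDiffOn.fderiv_apply_UHP {f : ℝ × ℝ → ℝ} (hf : ContDiffOn ℝ ∞ f UHP) (v : ℝ × ℝ) :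
    ContDiffOn ℝ ∞ (fun z => fderiv ℝ f z v) UHP :=
  ((contDiffOn_infty_iff_fderiv_of_isOpen isOpen_UHP).1 hf).2.clm_apply contDiffOn_const

lemma ContDiffOn.pdx {f : ℝ × ℝ → ℝ} (hf : ContDiffOn ℝ ∞ f UHP) : ContDiffOn ℝ ∞ (pdx f) UHP :=
  hf.fderiv_apply_UHP (1, 0)

lemma ContDiffOn.pdy {f : ℝ × ℝ → ℝ} (hf : ContDiffOn ℝ ∞ f UHP) : ContDiffOn ℝ ∞ (pdy f) UHP :=
  hf.fderiv_apply_UHP (0, 1)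

lemma ContDiffOn.div_snd {f : ℝ × ℝ → ℝ} (hf : ContDiffOn ℝ ∞ f UHP) :
    ContDiffOn ℝ ∞ (fun w => f w / w.2) UHP :=
  hf.div contDiffOn_snd fun _ hz => ne_of_gt hz

lemma ContDiffOn.mul_snd {f : ℝ × ℝ → ℝ} (hf : ContDiffOn ℝ ∞ f UHP) :
    ContDiffOn ℝ ∞ (fun w => f w * w.2) UHP :=
  hf.mul contDiffOn_snd

section Rules

variable {f g : ℝ × ℝ → ℝ} {z : ℝ × ℝ}

lemma fderiv_congr_UHP (h : ∀ w ∈ UHP, f w = g w) (hz : z ∈ UHP) :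
    fderiv ℝ f z = fderiv ℝ g z :=
  Filter.EventuallyEq.fderiv_eq (Filter.eventually_of_mem (UHP_mem_nhds hz) h)

lemma pdx_congr (h : ∀ w ∈ UHP, f w = g w) (hz : z ∈ UHP) : pdx f z = pdx g z := by
  rw [pdx, pdx, fderiv_congr_UHP h hz]

lemma pdy_congr (h : ∀ w ∈ UHP, f w = g w) (hz : z ∈ UHP) : pdy f z = pdy g z := by
  rw [pdy, pdy, fderiv_congr_UHP h hz]

lemma pdx_add (hf : DifferentiableAt ℝ f z) (hg : DifferentiableAt ℝ g z) :
    pdx (fun w => f w + g w) z = pdx f z + pdx g z := by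
  simp [pdx, fderiv_fun_add hf hg]

lemma pdy_add (hf : DifferentiableAt ℝ f z) (hg : DifferentiableAt ℝ g z) :
    pdy (fun w => f w + g w) z = pdy f z + pdy g z := by
  simp [pdy, fderiv_fun_add hf hg]

lemma pdx_sub (hf : DifferentiableAt ℝ f z) (hg : DifferentiableAt ℝ g z) :
    pdx (fun w => f w - g w) z = pdx f z - pdx g z := by
  simp [pdx, fderiv_fun_sub hf hg]

lemma pdy_sub (hf : DifferentiableAt ℝ f z) (hg : DifferentiableAt ℝ g z) :
    pdy (fun w => f w - g w) z = pdy f z - pdy g z := by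
  simp [pdy, fderiv_fun_sub hf hg]

lemma pdx_mul_snd (hf : DifferentiableAt ℝ f z) : pdx (fun w => f w * w.2) z = pdx f z * z.2 := by
  simp [pdx, fderiv_fun_mul hf differentiableAt_snd, fderiv_snd]
  ring

lemma pdy_mul_snd (hf : DifferentiableAt ℝ f z) :
    pdy (fun w => f w * w.2) z = pdy f z * z.2 + f z := by
  simp [pdy, fderiv_fun_mul hf differentiableAt_snd, fderiv_snd]
  ring

lemma DifferentiableAt.div_snd (hf : DifferentiableAt ℝ f z) (hz : z ∈ UHP) :
    DifferentiableAt ℝ (fun w => f w / w.2) z := by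
  simp only [div_eq_mul_inv]
  exact hf.fun_mul (differentiableAt_snd.fun_inv (ne_of_gt hz))

lemma pdx_div_snd (hf : DifferentiableAt ℝ f z) (hz : z ∈ UHP) :
    pdx (fun w => f w / w.2) z = pdx f z / z.2 := by
  have hy : z.2 ≠ 0 := ne_of_gt hz
  have h := pdx_mul_snd (hf.div_snd hz)
  rw [pdx_congr (g := f) (fun w hw => div_mul_cancel₀ _ (ne_of_gt hw)) hz] at h
  rw [h, mul_div_cancel_right₀ _ hy]

lemma pdy_div_snd (hf : DifferentiableAt ℝ f z) (hz : z ∈ UHP) :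
    pdy (fun w => f w / w.2) z = pdy f z / z.2 - f z / z.2 ^ 2 := by
  have hy : z.2 ≠ 0 := ne_of_gt hz
  have h := pdy_mul_snd (hf.div_snd hz)
  rw [pdy_congr (g := f) (fun w hw => div_mul_cancel₀ _ (ne_of_gt hw)) hz] at h
  rw [h]
  field_simp
  ring

/-- Mixed partial derivatives of a smooth function commute. -/
lemma pdy_pdx_comm (hf : ContDiffOn ℝ ∞ f UHP) (hz : z ∈ UHP) :
    pdy (pdx f) z = pdx (pdy f) z := by
  have hd : DifferentiableAt ℝ (fderiv ℝ f) z :=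
    (((contDiffOn_infty_iff_fderiv_of_isOpen isOpen_UHP).1 hf).2.contDiffAt
      (UHP_mem_nhds hz)).differentiableAt (by simp)
  have key (u v : ℝ × ℝ) :
      fderiv ℝ (fun w => fderiv ℝ f w u) z v = fderiv ℝ (fderiv ℝ f) z v u := by
    simp [fderiv_clm_apply hd (differentiableAt_const u)]
  have hs : IsSymmSndFDerivAt ℝ f z :=
    (hf.contDiffAt (UHP_mem_nhds hz)).isSymmSndFDerivAt
      (by simpa using WithTop.coe_le_coe.2 (le_top (a := (2 : ℕ∞))))
  exact (key (1, 0) (0, 1)).trans ((hs (0, 1) (1, 0)).trans (key (0, 1) (1, 0)).symm)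

end Rules

/-- The Poincaré lemma on the upper half-plane, in coordinates. -/
lemma exists_contDiffOn_pdx_eq_pdy_eq {P Q : ℝ × ℝ → ℝ} (hP : ContDiffOn ℝ ∞ P UHP)
    (hQ : ContDiffOn ℝ ∞ Q UHP) (h : ∀ z ∈ UHP, pdy P z = pdx Q z) :
    ∃ F : ℝ × ℝ → ℝ, ContDiffOn ℝ ∞ F UHP ∧ ∀ z ∈ UHP, pdx F z = P z ∧ pdy F z = Q z := by
  let η : ℝ × ℝ → ℝ × ℝ →L[ℝ] ℝ := fun z =>
    P z • ContinuousLinearMap.fst ℝ ℝ ℝ + Q z • ContinuousLinearMap.snd ℝ ℝ ℝ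
  have hη : ContDiffOn ℝ ∞ η UHP := (hP.smul contDiffOn_const).add (hQ.smul contDiffOn_const)
  have hd : ∀ a ∈ UHP, ∀ x y, fderiv ℝ η a x y = fderiv ℝ η a y x := by
    intro a ha x y
    have hPa := (hP.differentiableAt_of_mem_UHP ha).hasFDerivAt
    have hQa := (hQ.differentiableAt_of_mem_UHP ha).hasFDerivAt
    have hηa : HasFDerivAt η _ a :=
      (hPa.smul_const (ContinuousLinearMap.fst ℝ ℝ ℝ)).add
        (hQa.smul_const (ContinuousLinearMap.snd ℝ ℝ ℝ))
    have split (L : ℝ × ℝ →L[ℝ] ℝ) (v : ℝ × ℝ) : L v = v.1 * L (1, 0) + v.2 * L (0, 1) := by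
      rw [← smul_eq_mul, ← smul_eq_mul, ← map_smul, ← map_smul, ← map_add]
      simp
    have hc : fderiv ℝ P a (0, 1) = fderiv ℝ Q a (1, 0) := h a ha
    rw [hηa.fderiv]
    simp only [add_apply, ContinuousLinearMap.smulRight_apply,
      ContinuousLinearMap.coe_fst', ContinuousLinearMap.coe_snd', smul_eq_mul,
      smul_apply]
    rw [split (fderiv ℝ P a) x, split (fderiv ℝ P a) y, split (fderiv ℝ Q a) x,
      split (fderiv ℝ Q a) y, hc]
    ring
  obtain ⟨F, hF⟩ := convex_UHP.exists_forall_hasFDerivAt_of_fderiv_symmetric isOpen_UHP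
    (hη.differentiableOn (by simp)) hd
  refine ⟨F, (contDiffOn_infty_iff_fderiv_of_isOpen isOpen_UHP).2
    ⟨fun z hz => (hF z hz).differentiableAt.differentiableWithinAt,
      hη.congr fun z hz => (hF z hz).fderiv⟩, fun z hz => ?_⟩
  simp [pdx, pdy, (hF z hz).fderiv, η]

/-- The components of `∇dE + RgE` satisfy the covariant closedness equations. -/
lemma covariantly_closed_of_eq_nabla_d_Rg {S₁₁ S₁₂ S₂₂ E : ℝ × ℝ → ℝ}
    (hE : ContDiffOn ℝ ∞ E UHP)
    (hS : ∀ z ∈ UHP,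
      S₁₁ z = pdx (pdx E) z - pdy E z / z.2 - E z / z.2 ^ 2 ∧
      S₁₂ z = pdx (pdy E) z + pdx E z / z.2 ∧
      S₂₂ z = pdy (pdy E) z + pdy E z / z.2 - E z / z.2 ^ 2)
    {z : ℝ × ℝ} (hz : z ∈ UHP) :
    pdx S₁₂ z + (S₁₁ z - S₂₂ z) / z.2 = pdy S₁₁ z + 2 * S₁₁ z / z.2 ∧
      pdx S₂₂ z = pdy S₁₂ z := by
  have hy : z.2 ≠ 0 := ne_of_gt hz
  have d {f : ℝ × ℝ → ℝ} (hf : ContDiffOn ℝ ∞ f UHP) : DifferentiableAt ℝ f z :=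
    hf.differentiableAt_of_mem_UHP hz
  have e11 : ∀ w ∈ UHP, S₁₁ w = pdx (pdx E) w - pdy E w / w.2 - E w / w.2 / w.2 := fun w hw => by
    rw [(hS w hw).1, div_div, sq]
  have e22 : ∀ w ∈ UHP, S₂₂ w = pdy (pdy E) w + pdy E w / w.2 - E w / w.2 / w.2 := fun w hw => by
    rw [(hS w hw).2.2, div_div, sq]
  have c : pdy (pdx (pdx E)) z = pdx (pdx (pdy E)) z := by
    rw [pdy_pdx_comm hE.pdx hz]
    exact pdx_congr (fun w hw => pdy_pdx_comm hE hw) hz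
  have x12 : pdx S₁₂ z = pdx (pdx (pdy E)) z + pdx (pdx E) z / z.2 := by
    rw [pdx_congr (fun w hw => (hS w hw).2.1) hz, pdx_add (d hE.pdy.pdx) (d hE.pdx.div_snd),
      pdx_div_snd (d hE.pdx) hz]
  have y12 : pdy S₁₂ z =
      pdy (pdx (pdy E)) z + (pdx (pdy E) z / z.2 - pdx E z / z.2 ^ 2) := by
    rw [pdy_congr (fun w hw => (hS w hw).2.1) hz, pdy_add (d hE.pdy.pdx) (d hE.pdx.div_snd),
      pdy_div_snd (d hE.pdx) hz, pdy_pdx_comm hE hz]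
  have y11 : pdy S₁₁ z = pdx (pdx (pdy E)) z - (pdy (pdy E) z / z.2 - pdy E z / z.2 ^ 2) -
      ((pdy E z / z.2 - E z / z.2 ^ 2) / z.2 - E z / z.2 / z.2 ^ 2) := by
    rw [pdy_congr e11 hz, pdy_sub (d (hE.pdx.pdx.sub hE.pdy.div_snd)) (d hE.div_snd.div_snd),
      pdy_sub (d hE.pdx.pdx) (d hE.pdy.div_snd), pdy_div_snd (d hE.pdy) hz,
      pdy_div_snd (d hE.div_snd) hz, pdy_div_snd (d hE) hz, c]
  have x22 : pdx S₂₂ z = pdx (pdy (pdy E)) z + pdx (pdy E) z / z.2 - pdx E z / z.2 / z.2 := by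
    rw [pdx_congr e22 hz, pdx_sub (d (hE.pdy.pdy.add hE.pdy.div_snd)) (d hE.div_snd.div_snd),
      pdx_add (d hE.pdy.pdy) (d hE.pdy.div_snd), pdx_div_snd (d hE.pdy) hz,
      pdx_div_snd (d hE.div_snd) hz, pdx_div_snd (d hE) hz]
  constructor
  · rw [x12, y11, (hS z hz).1, (hS z hz).2.2]
    field_simp
    ring
  · rw [x22, y12, pdy_pdx_comm hE.pdy hz]
    field_simp
    ring

/-- A covariantly closed symmetric 2-tensor is of the form `∇dE + RgE`. The potential is `E = F / y`
with `F_x = α`, `F_y = G y`, where `dG = S₁₂ dx + S₂₂ dy` and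
`dα = (S₁₁ y + G) dx + S₁₂ y dy`. -/
lemma exists_eq_nabla_d_Rg_of_covariantly_closed {S₁₁ S₁₂ S₂₂ : ℝ × ℝ → ℝ}
    (h11 : ContDiffOn ℝ ∞ S₁₁ UHP) (h12 : ContDiffOn ℝ ∞ S₁₂ UHP) (h22 : ContDiffOn ℝ ∞ S₂₂ UHP)
    (hS : ∀ z ∈ UHP,
      pdx S₁₂ z + (S₁₁ z - S₂₂ z) / z.2 = pdy S₁₁ z + 2 * S₁₁ z / z.2 ∧
      pdx S₂₂ z = pdy S₁₂ z) :
    ∃ E : ℝ × ℝ → ℝ, ContDiffOn ℝ ∞ E UHP ∧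
      ∀ z ∈ UHP,
        S₁₁ z = pdx (pdx E) z - pdy E z / z.2 - E z / z.2 ^ 2 ∧
        S₁₂ z = pdx (pdy E) z + pdx E z / z.2 ∧
        S₂₂ z = pdy (pdy E) z + pdy E z / z.2 - E z / z.2 ^ 2 := by
  obtain ⟨G, hG, dG⟩ := exists_contDiffOn_pdx_eq_pdy_eq h12 h22 fun z hz => (hS z hz).2.symm
  obtain ⟨α, hα, dα⟩ := exists_contDiffOn_pdx_eq_pdy_eq (h11.mul_snd.add hG) h12.mul_snd
    fun z hz => by
      have hy : z.2 ≠ 0 := ne_of_gt hz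
      have h := (hS z hz).1
      field_simp at h
      have d11 := h11.differentiableAt_of_mem_UHP hz
      refine (pdy_add (h11.mul_snd.differentiableAt_of_mem_UHP hz)
        (hG.differentiableAt_of_mem_UHP hz)).trans ?_
      rw [pdy_mul_snd d11, pdx_mul_snd (h12.differentiableAt_of_mem_UHP hz), (dG z hz).2]
      linear_combination -h
  obtain ⟨F, hF, dF⟩ := exists_contDiffOn_pdx_eq_pdy_eq hα hG.mul_snd fun z hz => by
    rw [(dα z hz).2, pdx_mul_snd (hG.differentiableAt_of_mem_UHP hz), (dG z hz).1]
  have hE := hF.div_snd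
  set E : ℝ × ℝ → ℝ := fun w => F w / w.2 with E_def
  have Ex : ∀ w ∈ UHP, pdx E w = α w / w.2 := fun w hw => by
    rw [pdx_div_snd (hF.differentiableAt_of_mem_UHP hw) hw, (dF w hw).1]
  have Ey : ∀ w ∈ UHP, pdy E w = G w - E w / w.2 := fun w hw => by
    have hy : w.2 ≠ 0 := ne_of_gt hw
    rw [pdy_div_snd (hF.differentiableAt_of_mem_UHP hw) hw, (dF w hw).2, E_def]
    field_simp
  refine ⟨E, hE, fun z hz => ?_⟩
  have hy : z.2 ≠ 0 := ne_of_gt hz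
  have d {f : ℝ × ℝ → ℝ} (hf : ContDiffOn ℝ ∞ f UHP) : DifferentiableAt ℝ f z :=
    hf.differentiableAt_of_mem_UHP hz
  refine ⟨?_, ?_, ?_⟩
  · rw [pdx_congr Ex hz, pdx_div_snd (d hα) hz, (dα z hz).1, Ey z hz]
    field_simp
    ring
  · rw [pdx_congr Ey hz, pdx_sub (d hG) (d hE.div_snd), pdx_div_snd (d hE) hz, (dG z hz).1]
    ring
  · rw [pdy_congr Ey hz, pdy_sub (d hG) (d hE.div_snd), pdy_div_snd (d hE) hz, (dG z hz).2]
    ring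

/-- A smooth symmetric 2-tensor `S` on the upper half-plane (with components
`S₁₁, S₁₂ = S₂₁, S₂₂`) satisfies the covariant closedness equations `DS = 0` for the
hyperbolic metric, namely `∂_x S₁₂ + (S₁₁ − S₂₂)/y = ∂_y S₁₁ + 2S₁₁/y` and
`∂_x S₂₂ = ∂_y S₁₂`, iff `S = ∇dE + RgE` for some smooth function `E`, i.e.
`S₁₁ = E_xx − E_y/y − E/y²`, `S₁₂ = E_xy + E_x/y`, `S₂₂ = E_yy + E_y/y − E/y²`. -/
theorem covariantly_closed_iff_nabla_d_Rg
    (S₁₁ S₁₂ S₂₂ : (ℝ × ℝ) → ℝ)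
    (h11 : ContDiffOn ℝ (⊤ : ℕ∞) S₁₁ UHP)
    (h12 : ContDiffOn ℝ (⊤ : ℕ∞) S₁₂ UHP)
    (h22 : ContDiffOn ℝ (⊤ : ℕ∞) S₂₂ UHP) :
    (∀ z ∈ UHP,
        pdx S₁₂ z + (S₁₁ z - S₂₂ z) / z.2 = pdy S₁₁ z + 2 * S₁₁ z / z.2 ∧
        pdx S₂₂ z = pdy S₁₂ z) ↔
    (∃ E : (ℝ × ℝ) → ℝ, ContDiffOn ℝ (⊤ : ℕ∞) E UHP ∧
      ∀ z ∈ UHP,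
        S₁₁ z = pdx (fun w => pdx E w) z - pdy E z / z.2 - E z / z.2 ^ 2 ∧
        S₁₂ z = pdx (fun w => pdy E w) z + pdx E z / z.2 ∧
        S₂₂ z = pdy (fun w => pdy E w) z + pdy E z / z.2 - E z / z.2 ^ 2) := by
  exact ⟨exists_eq_nabla_d_Rg_of_covariantly_closed h11 h12 h22,
    fun ⟨_, hE, hS⟩ _ hz => covariantly_closed_of_eq_nabla_d_Rg hE hS hz⟩
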